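/- arXiv:2601.04256 — 2 statements merged into one kernel-verified Lean document; each statement's English description precedes it below -/
import Mathlib

section
/- Let X be a topological space. For every monitorable subset M ⊆ X there exists a unique pair (O, N) with O ⊆ X regular open and N ⊆ X nowhere dense such that M = O △ N (symmetric difference). -/
/-- A subset `A` of a topological space is *monitorable* if there is no nonempty open set
`U` such that `U ⊆ closure A` and `U ⊆ closure Aᶜ`. -/
def Monitorable {X : Type*} [TopologicalSpace X] (A : Set X) : Prop :=
  ¬ ∃ U : Set X, IsOpen U ∧ U.Nonempty ∧ U ⊆ closure A ∧ U ⊆ closure Aᶜ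

theorem Monitorable.interior_frontier_eq_empty {X : Type*} [TopologicalSpace X] {A : Set X}
    (hA : Monitorable A) : interior (frontier A) = ∅ := by
  by_contra h
  refine hA ⟨interior (frontier A), isOpen_interior, Set.nonempty_iff_ne_empty.2 h, ?_, ?_⟩
  · exact interior_subset.trans frontier_subset_closure
  · rw [← frontier_compl]
    exact interior_subset.trans frontier_subset_closure

theorem Monitorable.isNowhereDense_frontier {X : Type*} [TopologicalSpace X] {A : Set X}
    (hA : Monitorable A) : IsNowhereDense (frontier A) :=
  isClosed_frontier.isNowhereDense_iff.2 hA.interior_frontier_eq_empty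

theorem symmDiff_interior_closure_subset_frontier {X : Type*} [TopologicalSpace X] (A : Set X) :
    symmDiff (interior (closure A)) A ⊆ frontier A := by
  rintro x (⟨hx, hxA⟩ | ⟨hxA, hx⟩)
  · exact ⟨interior_subset hx, fun h => hxA (interior_subset h)⟩
  · exact ⟨subset_closure hxA, fun h => hx (interior_mono subset_closure h)⟩

theorem IsNowhereDense.interior_closure_subset_of_subset_union {X : Type*} [TopologicalSpace X]
    {A B N : Set X} (hN : IsNowhereDense N) (h : A ⊆ B ∪ N) :
    interior (closure A) ⊆ interior (closure B) := by
  rw [← interior_union_isClosed_of_interior_empty (isClosed_closure (s := B)) hN, ← closure_union]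
  exact interior_mono (closure_mono h)

theorem IsNowhereDense.interior_closure_symmDiff {X : Type*} [TopologicalSpace X]
    {A N : Set X} (hN : IsNowhereDense N) :
    interior (closure (symmDiff A N)) = interior (closure A) := by
  refine (hN.interior_closure_subset_of_subset_union ?_).antisymm
    (hN.interior_closure_subset_of_subset_union ?_)
  · exact symmDiff_le_sup
  · intro x hx
    by_cases hxN : x ∈ N
    · exact Or.inr hxN
    · exact Or.inl (Or.inl ⟨hx, hxN⟩)

/-- Every monitorable set is, in a unique way, the symmetric difference of a regular open
set and a nowhere dense set. -/
theorem monitorable_unique_regularOpen_symmDiff_nowhereDense {X : Type*} [TopologicalSpace X]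
    (M : Set X) (hM : Monitorable M) :
    ∃! p : Set X × Set X,
      (IsOpen p.1 ∧ p.1 = interior (closure p.1)) ∧ IsNowhereDense p.2 ∧
        M = symmDiff p.1 p.2 := by
  refine ⟨(interior (closure M), symmDiff (interior (closure M)) M),
    ⟨⟨isOpen_interior, ?_⟩, ?_, ?_⟩, ?_⟩
  · exact interior_closure_idem.symm
  · exact hM.isNowhereDense_frontier.mono (symmDiff_interior_closure_subset_frontier M)
  · exact (symmDiff_symmDiff_cancel_left _ _).symm
  · rintro ⟨O, N⟩ ⟨⟨-, hO⟩, hN, rfl⟩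
    simp only at hO hN ⊢
    rw [hN.interior_closure_symmDiff, ← hO, symmDiff_symmDiff_cancel_left]
end

section
/- Let X be a countable, second countable topological space. If the family of monitorable subsets of X is not a closed subset of P(X) (with the product topology of 2^X), then there exists a continuous function f : (ℕ → Bool) → P(X) such that for every α : ℕ → Bool, the set f(α) is monitorable in X if and only if the set {n ∈ ℕ | α(n) = true} is finite. -/
/-- A sequence of infinite sets has an injective choice of representatives. -/
theorem exists_injective_forall_mem_of_infinite {X : Type*} (S : ℕ → Set X)
    (hS : ∀ n, (S n).Infinite) : ∃ p : ℕ → X, Function.Injective p ∧ ∀ n, p n ∈ S n := by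
  classical
  choose c hcS hc using fun n (F : Finset X) => (hS n).exists_notMem_finset F
  let p : ℕ → X := fun n => Nat.strongRec (motive := fun _ => X)
    (fun n ih => c n (Finset.univ.image fun i : Fin n => ih i i.2)) n
  have hp : ∀ n, p n = c n (Finset.univ.image fun i : Fin n => p i) := fun n => by
    simp only [p]
    rw [Nat.strongRec]
  refine ⟨p, ?_, fun n => hp n ▸ hcS n _⟩
  have hlt : ∀ m n, m < n → p m ≠ p n := fun m n hmn heq =>
    hc n (Finset.univ.image fun i : Fin n => p i)
      (hp n ▸ heq ▸ Finset.mem_image.2 ⟨⟨m, hmn⟩, Finset.mem_univ _, rfl⟩)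
  intro m n heq
  rcases lt_trichotomy m n with h | h | h
  · exact (hlt m n h heq).elim
  · exact h
  · exact (hlt n m h heq.symm).elim

/-- If every point of `D` can be avoided by shrinking any nonempty open subset of `W`, then so can
every finite subset of `D`. -/
theorem exists_open_disjoint_of_finite {X : Type*} [TopologicalSpace X] {W D F : Set X}
    (hD : ∀ y ∈ D, ∀ V ⊆ W, IsOpen V → V.Nonempty →
      ∃ V' ⊆ V, IsOpen V' ∧ V'.Nonempty ∧ y ∉ V')
    (hF : F.Finite) (hFD : F ⊆ D) {V : Set X} (hVW : V ⊆ W) (hVo : IsOpen V)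
    (hVn : V.Nonempty) : ∃ V' ⊆ V, IsOpen V' ∧ V'.Nonempty ∧ Disjoint V' F := by
  induction F, hF using Set.Finite.induction_on with
  | empty => exact ⟨V, subset_rfl, hVo, hVn, Set.disjoint_empty V⟩
  | @insert a s _ _ ih =>
    obtain ⟨V₁, h₁, h₁o, h₁n, h₁s⟩ := ih ((Set.subset_insert a s).trans hFD)
    obtain ⟨V₂, h₂, h₂o, h₂n, h₂a⟩ :=
      hD a (hFD (Set.mem_insert a s)) V₁ (h₁.trans hVW) h₁o h₁n
    exact ⟨V₂, h₂.trans h₁, h₂o, h₂n, Set.disjoint_insert_right.2 ⟨h₂a, h₁s.mono_left h₂⟩⟩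

/-- The nonempty open subsets of a nonempty open set have a countable coinitial family. -/
theorem exists_seq_open_coinitial {X : Type*} [TopologicalSpace X] [SecondCountableTopology X]
    {W : Set X} (hWo : IsOpen W) (hWn : W.Nonempty) :
    ∃ B : ℕ → Set X, (∀ k, B k ⊆ W ∧ IsOpen (B k) ∧ (B k).Nonempty) ∧
      ∀ V ⊆ W, IsOpen V → V.Nonempty → ∃ k, B k ⊆ V := by
  obtain ⟨b, hbc, -, hb⟩ := TopologicalSpace.exists_countable_basis X
  have hsub : ∀ V ⊆ W, IsOpen V → V.Nonempty → ∃ t ∈ {t ∈ b | t ⊆ W ∧ t.Nonempty}, t ⊆ V := by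
    rintro V hVW hVo ⟨x, hx⟩
    obtain ⟨t, htb, hxt, htV⟩ := hb.exists_subset_of_mem_open hx hVo
    exact ⟨t, ⟨htb, htV.trans hVW, x, hxt⟩, htV⟩
  obtain ⟨t, ht, -⟩ := hsub W subset_rfl hWo hWn
  obtain ⟨B, hB⟩ := (hbc.mono (Set.sep_subset b fun t => t ⊆ W ∧ t.Nonempty)).exists_eq_range ⟨t, ht⟩
  refine ⟨B, fun k => ?_, fun V hVW hVo hVn => ?_⟩
  · have hk : B k ∈ {t ∈ b | t ⊆ W ∧ t.Nonempty} := hB ▸ Set.mem_range_self k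
    exact ⟨hk.2.1, hb.isOpen hk.1, hk.2.2⟩
  · obtain ⟨t, ht, htV⟩ := hsub V hVW hVo hVn
    rw [hB] at ht
    obtain ⟨k, rfl⟩ := ht
    exact ⟨k, htV⟩

/-- A finite set of avoidable points is monitorable. -/
theorem monitorable_of_finite_avoidable {X : Type*} [TopologicalSpace X] {W D F : Set X}
    (hWo : IsOpen W) (hDW : D ⊆ W)
    (hD : ∀ y ∈ D, ∀ V ⊆ W, IsOpen V → V.Nonempty →
      ∃ V' ⊆ V, IsOpen V' ∧ V'.Nonempty ∧ y ∉ V')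
    (hF : F.Finite) (hFD : F ⊆ D) : Monitorable F := by
  rintro ⟨U, hUo, ⟨u, hu⟩, hUF, -⟩
  obtain ⟨x, hxU, hxF⟩ := mem_closure_iff.1 (hUF hu) U hUo hu
  obtain ⟨V, hVU, hVo, ⟨v, hv⟩, hVF⟩ := exists_open_disjoint_of_finite hD hF hFD
    (Set.inter_subset_right : U ∩ W ⊆ W) (hUo.inter hWo) ⟨x, hxU, hDW (hFD hxF)⟩
  obtain ⟨y, hyV, hyF⟩ := mem_closure_iff.1 (hUF (hVU hv).1) V hVo hv
  exact Set.disjoint_left.1 hVF hyV hyF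

/-- If a nonempty open set `W` has a dense set of avoidable points, then the eventually-`false`
sequences reduce continuously to the monitorable sets. -/
theorem exists_reduction_of_dense_avoidable {X : Type*} [TopologicalSpace X]
    [SecondCountableTopology X] {W D : Set X} (hWo : IsOpen W) (hWn : W.Nonempty) (hDW : D ⊆ W)
    (hD : ∀ y ∈ D, ∀ V ⊆ W, IsOpen V → V.Nonempty →
      ∃ V' ⊆ V, IsOpen V' ∧ V'.Nonempty ∧ y ∉ V')
    (hdense : ∀ V ⊆ W, IsOpen V → V.Nonempty → (V ∩ D).Nonempty) :
    ∃ f : (ℕ → Bool) → (X → Bool), Continuous f ∧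
      ∀ α : ℕ → Bool,
        (Monitorable {x : X | f α x = true} ↔ {n : ℕ | α n = true}.Finite) := by
  classical
  obtain ⟨B, hB, hBc⟩ := exists_seq_open_coinitial hWo hWn
  have hinf : ∀ k, (B k ∩ D).Infinite := by
    intro k hfin
    obtain ⟨hkW, hko, hkn⟩ := hB k
    obtain ⟨V, hVk, hVo, hVn, hVd⟩ :=
      exists_open_disjoint_of_finite hD hfin Set.inter_subset_right hkW hko hkn
    obtain ⟨x, hxV, hxD⟩ := hdense V (hVk.trans hkW) hVo hVn
    exact Set.disjoint_left.1 hVd hxV ⟨hVk hxV, hxD⟩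
  obtain ⟨q, hq, hqB⟩ := exists_injective_forall_mem_of_infinite
    (fun i => B i.unpair.2 ∩ D) fun i => hinf _
  have hpB : ∀ n k, q (Nat.pair n k) ∈ B k ∩ D := fun n k => by
    simpa using hqB (Nat.pair n k)
  have hp : ∀ {n k n' k'}, q (Nat.pair n k) = q (Nat.pair n' k') → n = n' ∧ k = k' :=
    fun h => Nat.pair_eq_pair.1 (hq h)
  -- The points with first index `0` stay outside every value of the reduction.
  let f : (ℕ → Bool) → (X → Bool) := fun α x =>
    decide (∃ n k, k ≤ n ∧ α n = true ∧ q (Nat.pair (n + 1) k) = x)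
  have hf : ∀ α x, f α x = true ↔ ∃ n k, k ≤ n ∧ α n = true ∧ q (Nat.pair (n + 1) k) = x :=
    fun α x => decide_eq_true_iff
  refine ⟨f, continuous_pi fun x => ?_, fun α => ⟨fun hmon => ?_, fun hfin => ?_⟩⟩
  · by_cases hx : ∃ n k, k ≤ n ∧ q (Nat.pair (n + 1) k) = x
    · obtain ⟨n, k, hkn, rfl⟩ := hx
      have : (fun α => f α (q (Nat.pair (n + 1) k))) = fun α : ℕ → Bool => α n := by
        funext α
        rw [Bool.eq_iff_iff, hf]
        constructor
        · rintro ⟨n', k', -, hα, heq⟩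
          obtain rfl : n' = n := Nat.succ_injective (hp heq).1
          exact hα
        · exact fun hα => ⟨n, k, hkn, hα, rfl⟩
      rw [this]
      exact continuous_apply n
    · have : (fun α => f α x) = fun _ => false := by
        funext α
        rw [Bool.eq_false_iff, Ne, hf]
        rintro ⟨n, k, hkn, -, heq⟩
        exact hx ⟨n, k, hkn, heq⟩
      rw [this]
      exact continuous_const
  · by_contra hinfα
    refine hmon ⟨W, hWo, hWn, fun w hw => mem_closure_iff.2 fun O hO hwO => ?_,
      fun w hw => mem_closure_iff.2 fun O hO hwO => ?_⟩
    · obtain ⟨k, hk⟩ := hBc (O ∩ W) Set.inter_subset_right (hO.inter hWo) ⟨w, hwO, hw⟩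
      obtain ⟨n, hn, hkn⟩ := Set.Infinite.exists_gt hinfα k
      exact ⟨q (Nat.pair (n + 1) k), (hk (hpB _ k).1).1,
        (hf _ _).2 ⟨n, k, hkn.le, hn, rfl⟩⟩
    · obtain ⟨k, hk⟩ := hBc (O ∩ W) Set.inter_subset_right (hO.inter hWo) ⟨w, hwO, hw⟩
      refine ⟨q (Nat.pair 0 k), (hk (hpB _ k).1).1, fun hmem => ?_⟩
      obtain ⟨n, k', -, -, heq⟩ := (hf _ _).1 hmem
      exact Nat.succ_ne_zero n (hp heq).1
  · refine monitorable_of_finite_avoidable hWo hDW hD ?_ ?_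
    · refine (hfin.biUnion fun n _ =>
        (Set.finite_Iic n).image fun k => q (Nat.pair (n + 1) k)).subset fun x hx => ?_
      obtain ⟨n, k, hkn, hα, rfl⟩ := (hf _ _).1 hx
      exact Set.mem_biUnion (show n ∈ {n | α n = true} from hα) ⟨k, hkn, rfl⟩
    · intro x hx
      obtain ⟨n, k, -, -, rfl⟩ := (hf _ _).1 hx
      exact (hpB _ _).2

/-- A nonempty open set without minimal nonempty open subsets contains a nonempty open set with a
dense set of avoidable points. -/
theorem exists_dense_avoidable {X : Type*} [TopologicalSpace X] {U : Set X} (hUo : IsOpen U)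
    (hUn : U.Nonempty)
    (hU : ∀ V ⊆ U, IsOpen V → V.Nonempty → ∃ V' ⊆ V, IsOpen V' ∧ V'.Nonempty ∧ ¬ V ⊆ V') :
    ∃ W D : Set X, IsOpen W ∧ W.Nonempty ∧ D ⊆ W ∧
      (∀ y ∈ D, ∀ V ⊆ W, IsOpen V → V.Nonempty →
        ∃ V' ⊆ V, IsOpen V' ∧ V'.Nonempty ∧ y ∉ V') ∧
      ∀ V ⊆ W, IsOpen V → V.Nonempty → (V ∩ D).Nonempty := by
  by_cases hcore : ∃ W ⊆ U, IsOpen W ∧ W.Nonempty ∧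
      ∃ x, ∀ V ⊆ W, IsOpen V → V.Nonempty → x ∈ V
  · obtain ⟨W, hWU, hWo, hWn, x, hx⟩ := hcore
    refine ⟨W, {y ∈ W | ∃ V ⊆ W, IsOpen V ∧ V.Nonempty ∧ y ∉ V}, hWo, hWn,
      Set.sep_subset _ _, ?_, fun V hVW hVo hVn => ?_⟩
    · rintro y ⟨-, O, hOW, hOo, hOn, hyO⟩ V hVW hVo hVn
      exact ⟨V ∩ O, Set.inter_subset_left, hVo.inter hOo,
        ⟨x, hx V hVW hVo hVn, hx O hOW hOo hOn⟩, fun hy => hyO hy.2⟩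
    · obtain ⟨V', hV', hVo', hVn', hne⟩ := hU V (hVW.trans hWU) hVo hVn
      obtain ⟨y, hyV, hyV'⟩ := Set.not_subset.1 hne
      exact ⟨y, hyV, hVW hyV, V', hV'.trans hVW, hVo', hVn', hyV'⟩
  · push Not at hcore
    refine ⟨U, U, hUo, hUn, subset_rfl, fun y _ V hVU hVo hVn => hcore V hVU hVo hVn y,
      fun V hVU _ hVn => ?_⟩
    rwa [Set.inter_eq_left.2 hVU]

/-- If every nonempty open set contains a minimal one, the monitorable sets form a closed family. -/
theorem isClosed_monitorable {X : Type*} [TopologicalSpace X]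
    (h : ∀ U : Set X, IsOpen U → U.Nonempty →
      ∃ M ⊆ U, IsOpen M ∧ M.Nonempty ∧ ∀ V ⊆ M, IsOpen V → V.Nonempty → M ⊆ V) :
    IsClosed {f : X → Bool | Monitorable {x : X | f x = true}} := by
  have key : {f : X → Bool | Monitorable {x : X | f x = true}} =
      {f | ∀ x y, (∃ M : Set X, IsOpen M ∧ (∀ V ⊆ M, IsOpen V → V.Nonempty → M ⊆ V) ∧
        x ∈ M ∧ y ∈ M) → f x = f y} := by
    ext f
    constructor
    · rintro hf x y ⟨M, hMo, hM, hx, hy⟩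
      have hdense : ∀ (A : Set X) (z : X), z ∈ M → z ∈ A → M ⊆ closure A :=
        fun A z hzM hzA w hw => mem_closure_iff.2 fun O hO hwO =>
          ⟨z, (hM (O ∩ M) Set.inter_subset_right (hO.inter hMo) ⟨w, hwO, hw⟩ hzM).1, hzA⟩
      by_contra hne
      cases hfx : f x <;> cases hfy : f y
      · exact hne (hfx.trans hfy.symm)
      · exact hf ⟨M, hMo, ⟨x, hx⟩, hdense _ y hy hfy, hdense _ x hx (by simp [hfx])⟩
      · exact hf ⟨M, hMo, ⟨x, hx⟩, hdense _ x hx hfx, hdense _ y hy (by simp [hfy])⟩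
      · exact hne (hfx.trans hfy.symm)
    · rintro hf ⟨U, hUo, hUn, hU₁, hU₂⟩
      obtain ⟨M, hMU, hMo, ⟨m, hm⟩, hM⟩ := h U hUo hUn
      obtain ⟨x, hxM, hx⟩ := mem_closure_iff.1 (hU₁ (hMU hm)) M hMo hm
      obtain ⟨y, hyM, hy⟩ := mem_closure_iff.1 (hU₂ (hMU hm)) M hMo hm
      exact hy ((hf x y ⟨M, hMo, hM, hxM, hyM⟩).symm.trans hx)
  rw [key]
  simp only [Set.ofPred_forall]
  exact isClosed_iInter fun x => isClosed_iInter fun y => isClosed_iInter fun _ =>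
    isClosed_eq (continuous_apply x) (continuous_apply y)

/-- If the family of monitorable subsets of a countable, second countable space `X` is not
closed in `P(X) = X → Bool`, then it is `Σ⁰₂`-hard: the set of eventually-`false` binary
sequences Wadge reduces to it. -/
theorem monitorable_not_closed_Sigma02_hard {X : Type*} [TopologicalSpace X] [Countable X]
    [SecondCountableTopology X]
    (h : ¬ IsClosed {f : X → Bool | Monitorable {x : X | f x = true}}) :
    ∃ f : (ℕ → Bool) → (X → Bool), Continuous f ∧
      ∀ α : ℕ → Bool,
        (Monitorable {x : X | f α x = true} ↔ {n : ℕ | α n = true}.Finite) := by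
  have hU := mt isClosed_monitorable h
  push Not at hU
  obtain ⟨U, hUo, hUn, hU⟩ := hU
  obtain ⟨W, D, hWo, hWn, hDW, hD, hdense⟩ := exists_dense_avoidable hUo hUn hU
  exact exists_reduction_of_dense_avoidable hWo hWn hDW hD hdense
end
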